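/- Let M ∈ ℝ^{n×n} with spectral norm ‖M‖₂ ≤ 1, let W ∈ ℝ^{d×d} with ‖W‖₂ ≤ κ for some κ ∈ [0,1), let φ : ℝ → ℝ be 1-Lipschitz, and let X̃ ∈ ℝ^{n×d}. Then the fixed-point equilibrium equation Z = φ(M Z W + X̃) has a unique solution Z* ∈ ℝ^{n×d}, and for any initialization Z⁽¹⁾ ∈ ℝ^{n×d}, the fixed-point iteration Z⁽ᵗ⁺¹⁾ = φ(M Z⁽ᵗ⁾ W + X̃) converges to Z* (in Frobenius norm) as t → ∞. -/

import Mathlib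

open Matrix Filter

/-- Spectral norm (largest singular value) of a square real matrix. -/
noncomputable def specNorm {n : ℕ} (M : Matrix (Fin n) (Fin n) ℝ) : ℝ :=
  ‖Matrix.toEuclideanCLM (𝕜 := ℝ) M‖

/-- Frobenius norm of a real matrix. -/
noncomputable def frobNorm {n d : ℕ} (A : Matrix (Fin n) (Fin d) ℝ) : ℝ :=
  Real.sqrt (∑ i, ∑ j, (A i j) ^ 2)

lemma frobNorm_sq {n d : ℕ} (A : Matrix (Fin n) (Fin d) ℝ) :
    frobNorm A ^ 2 = ∑ i, ∑ j, (A i j) ^ 2 :=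
  Real.sq_sqrt (by positivity)

lemma frobNorm_nonneg {n d : ℕ} (A : Matrix (Fin n) (Fin d) ℝ) : 0 ≤ frobNorm A :=
  Real.sqrt_nonneg _

lemma specNorm_nonneg {n : ℕ} (M : Matrix (Fin n) (Fin n) ℝ) : 0 ≤ specNorm M :=
  norm_nonneg _

lemma frobNorm_transpose {n d : ℕ} (A : Matrix (Fin n) (Fin d) ℝ) : frobNorm Aᵀ = frobNorm A := by
  simp only [frobNorm, transpose_apply]
  rw [Finset.sum_comm]

open scoped Matrix.Norms.L2Operator in
lemma specNorm_transpose {n : ℕ} (M : Matrix (Fin n) (Fin n) ℝ) : specNorm Mᵀ = specNorm M := by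
  have h := l2_opNorm_conjTranspose M
  rwa [conjTranspose_eq_transpose_of_trivial] at h

lemma sum_sq_mulVec_le {n : ℕ} (M : Matrix (Fin n) (Fin n) ℝ) (v : Fin n → ℝ) :
    ∑ i, (M *ᵥ v) i ^ 2 ≤ specNorm M ^ 2 * ∑ i, v i ^ 2 := by
  have h := (Matrix.toEuclideanCLM (𝕜 := ℝ) M).le_opNorm (WithLp.toLp 2 v)
  have h2 := pow_le_pow_left₀ (norm_nonneg _) h 2
  rw [mul_pow, EuclideanSpace.real_norm_sq_eq, EuclideanSpace.real_norm_sq_eq] at h2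
  simpa only [ofLp_toEuclideanCLM, specNorm] using h2

lemma frobNorm_mul_le {n d : ℕ} (M : Matrix (Fin n) (Fin n) ℝ) (A : Matrix (Fin n) (Fin d) ℝ) :
    frobNorm (M * A) ≤ specNorm M * frobNorm A := by
  refine (sq_le_sq₀ (frobNorm_nonneg _) ?_).1 ?_
  · exact mul_nonneg (specNorm_nonneg M) (frobNorm_nonneg A)
  rw [mul_pow, frobNorm_sq, frobNorm_sq, Finset.sum_comm,
    Finset.sum_comm (f := fun i j => A i j ^ 2),
    Finset.mul_sum]
  exact Finset.sum_le_sum fun j _ => sum_sq_mulVec_le M fun i => A i j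

lemma frobNorm_mul_le' {n d : ℕ} (A : Matrix (Fin n) (Fin d) ℝ) (W : Matrix (Fin d) (Fin d) ℝ) :
    frobNorm (A * W) ≤ frobNorm A * specNorm W := by
  rw [← frobNorm_transpose, transpose_mul, mul_comm, ← frobNorm_transpose A, ← specNorm_transpose W]
  exact frobNorm_mul_le Wᵀ Aᵀ

lemma frobNorm_map_sub_map_le {n d : ℕ} {φ : ℝ → ℝ} (hφ : ∀ a b : ℝ, |φ a - φ b| ≤ |a - b|)
    (A B : Matrix (Fin n) (Fin d) ℝ) : frobNorm (A.map φ - B.map φ) ≤ frobNorm (A - B) :=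
  Real.sqrt_le_sqrt <| Finset.sum_le_sum fun i _ => Finset.sum_le_sum fun j _ =>
    sq_le_sq.2 (hφ (A i j) (B i j))

lemma frobNorm_equilibrium_sub_le {n d : ℕ} {M : Matrix (Fin n) (Fin n) ℝ}
    {W : Matrix (Fin d) (Fin d) ℝ} {κ : ℝ} (hM : specNorm M ≤ 1) (hW : specNorm W ≤ κ)
    {φ : ℝ → ℝ} (hφ : ∀ a b : ℝ, |φ a - φ b| ≤ |a - b|) (X Y Z : Matrix (Fin n) (Fin d) ℝ) :
    frobNorm ((M * Y * W + X).map φ - (M * Z * W + X).map φ) ≤ κ * frobNorm (Y - Z) :=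
  calc
    _ ≤ frobNorm (M * Y * W + X - (M * Z * W + X)) := frobNorm_map_sub_map_le hφ _ _
    _ = frobNorm (M * (Y - Z) * W) := by
      rw [add_sub_add_right_eq_sub, ← Matrix.sub_mul, ← Matrix.mul_sub]
    _ ≤ frobNorm (M * (Y - Z)) * specNorm W := frobNorm_mul_le' _ _
    _ ≤ frobNorm (Y - Z) * κ := by
      refine mul_le_mul ?_ hW (specNorm_nonneg W) (frobNorm_nonneg _)
      exact (frobNorm_mul_le _ _).trans (mul_le_of_le_one_left (frobNorm_nonneg _) hM)
    _ = κ * frobNorm (Y - Z) := mul_comm _ _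

open scoped Matrix.Norms.Frobenius in
lemma norm_eq_frobNorm {n d : ℕ} (A : Matrix (Fin n) (Fin d) ℝ) : ‖A‖ = frobNorm A := by
  simp [frobenius_norm_def, frobNorm, Real.sqrt_eq_rpow]

open scoped Matrix.Norms.Frobenius in
lemma exists_fixedPoint_of_frobNorm_contracting {n d : ℕ} {κ : ℝ} (hκ0 : 0 ≤ κ) (hκ1 : κ < 1)
    {f : Matrix (Fin n) (Fin d) ℝ → Matrix (Fin n) (Fin d) ℝ}
    (hf : ∀ Y Z, frobNorm (f Y - f Z) ≤ κ * frobNorm (Y - Z)) :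
    ∃ Zstar, f Zstar = Zstar ∧ (∀ Z, f Z = Z → Z = Zstar) ∧
      ∀ Z, Tendsto (fun t => frobNorm (f^[t] Z - Zstar)) atTop (nhds 0) := by
  have : CompleteSpace (Matrix (Fin n) (Fin d) ℝ) := FiniteDimensional.complete ℝ _
  have hc : ContractingWith ⟨κ, hκ0⟩ f :=
    ⟨hκ1, LipschitzWith.of_dist_le_mul fun Y Z => by
      rw [dist_eq_norm, dist_eq_norm, norm_eq_frobNorm, norm_eq_frobNorm]
      exact hf Y Z⟩
  refine ⟨hc.fixedPoint, hc.fixedPoint_isFixedPt, fun Z hZ => hc.fixedPoint_unique hZ, fun Z => ?_⟩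
  simpa only [norm_eq_frobNorm] using
    tendsto_iff_norm_sub_tendsto_zero.1 (hc.tendsto_iterate_fixedPoint Z)

/-- If `‖M‖₂ ≤ 1`, `‖W‖₂ ≤ κ` with `0 ≤ κ < 1`, and `φ` is `1`-Lipschitz,
the equation `Z = φ(M Z W + X̃)` has a unique solution `Z*`, and for any initialization the
fixed-point iteration `Z⁽ᵗ⁺¹⁾ = φ(M Z⁽ᵗ⁾ W + X̃)` converges to `Z*` in Frobenius norm. -/
theorem ihgnn_wellposed_and_convergent
    (n d : ℕ) (M : Matrix (Fin n) (Fin n) ℝ) (W : Matrix (Fin d) (Fin d) ℝ)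
    (κ : ℝ) (hκ0 : 0 ≤ κ) (hκ1 : κ < 1)
    (hM : specNorm M ≤ 1) (hW : specNorm W ≤ κ)
    (φ : ℝ → ℝ) (hφ : ∀ a b : ℝ, |φ a - φ b| ≤ |a - b|)
    (X : Matrix (Fin n) (Fin d) ℝ) :
    ∃ Zstar : Matrix (Fin n) (Fin d) ℝ,
      Zstar = ((M * Zstar * W + X).map φ) ∧
      (∀ Z : Matrix (Fin n) (Fin d) ℝ, Z = ((M * Z * W + X).map φ) → Z = Zstar) ∧
      (∀ Zseq : ℕ → Matrix (Fin n) (Fin d) ℝ,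
        (∀ t : ℕ, Zseq (t + 1) = ((M * Zseq t * W + X).map φ)) →
        Tendsto (fun t => frobNorm (Zseq t - Zstar)) atTop (nhds 0)) := by
  obtain ⟨Zstar, hfix, huniq, hlim⟩ := exists_fixedPoint_of_frobNorm_contracting hκ0 hκ1
    (frobNorm_equilibrium_sub_le hM hW hφ X)
  refine ⟨Zstar, hfix.symm, fun Z hZ => huniq Z hZ.symm, fun Zseq hZ => ?_⟩
  convert hlim (Zseq 0) using 4 with t
  induction t with
  | zero => rfl
  | succ t ih => rw [hZ, ih, Function.iterate_succ_apply']
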